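/- arXiv:2307.14992 — 2 statements merged into one kernel-verified Lean document; each statement's English description precedes it below -/
import Mathlib

section
/- Let K be a field of characteristic p, let v be an additive valuation on K, let θ ∈ K with v(θ) ≥ 0, and let n ≥ 1. Suppose F ∈ K[t] satisfies 1 − q ≤ ord_v(F) < 0 (in particular F ≠ 0). Then there is no g ∈ K[t] with g^{(1)} − (t−θ)^n·g = F. -/
open Polynomial

/-- The Frobenius twist `h^{(1)}` of a polynomial: each coefficient is raised to
the `q`-th power. -/
noncomputable def twist {L : Type*} [Field L] (q : ℕ) (h : Polynomial L) : Polynomial L :=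
  h.sum fun i c => Polynomial.C (c ^ q) * Polynomial.X ^ i

/-- An additive valuation on a field `K`: a map `v : K → ℤ ∪ {∞}` with `v x = ∞` iff `x = 0`,
`v(xy) = v x + v y` and `v(x+y) ≥ min (v x) (v y)`. -/
structure AddVal (K : Type*) [Field K] where
  v : K → WithTop ℤ
  eq_top_iff : ∀ x, v x = ⊤ ↔ x = 0
  map_mul : ∀ x y, v (x * y) = v x + v y
  add_le : ∀ x y, min (v x) (v y) ≤ v (x + y)

/-- `ord_v` of a polynomial: the minimum of `v` over its coefficients (`∞` for `0`). -/
noncomputable def ordv {K : Type*} [Field K] (w : AddVal K) (h : Polynomial K) : WithTop ℤ :=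
  (Finset.range (h.natDegree + 1)).inf fun i => w.v (h.coeff i)

theorem AddVal.v_one' {K : Type*} [Field K] (w : AddVal K) : w.v 1 = 0 := by
  have h := w.map_mul 1 1
  have h1 : w.v 1 ≠ ⊤ := by simp [w.eq_top_iff]
  rw [mul_one] at h
  lift w.v 1 to ℤ using h1 with a
  norm_cast at h ⊢
  omega

theorem AddVal.v_neg' {K : Type*} [Field K] (w : AddVal K) (x : K) : w.v (-x) = w.v x := by
  have h := w.map_mul (-1) (-1)
  have h1 : w.v (-1) ≠ ⊤ := by simp [w.eq_top_iff]
  have h2 : w.v (-1) = 0 := by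
    rw [neg_one_mul, neg_neg, w.v_one'] at h
    lift w.v (-1) to ℤ using h1 with a
    norm_cast at h ⊢
    omega
  have h3 := w.map_mul (-1) x
  rw [h2, zero_add, neg_one_mul] at h3
  exact h3

theorem AddVal.le_sub' {K : Type*} [Field K] (w : AddVal K) {c : WithTop ℤ} {x y : K}
    (hx : c ≤ w.v x) (hy : c ≤ w.v y) : c ≤ w.v (x - y) := by
  rw [sub_eq_add_neg]
  refine le_trans (le_min hx ?_) (w.add_le _ _)
  rwa [w.v_neg']

theorem AddVal.v_pow' {K : Type*} [Field K] (w : AddVal K) (x : K) (m : ℤ) (hx : w.v x = m)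
    (k : ℕ) : w.v (x ^ k) = ((k * m : ℤ) : WithTop ℤ) := by
  induction k with
  | zero => simp [w.v_one']
  | succ k ih =>
    rw [pow_succ, w.map_mul, ih, hx]
    norm_cast
    push_cast
    ring

theorem AddVal.pow_nonneg' {K : Type*} [Field K] (w : AddVal K) (x : K) (hx : 0 ≤ w.v x)
    (k : ℕ) : 0 ≤ w.v (x ^ k) := by
  induction k with
  | zero => simp [w.v_one']
  | succ k ih =>
    rw [pow_succ, w.map_mul]
    exact add_nonneg ih hx

theorem le_ordv_iff {K : Type*} [Field K] (w : AddVal K) (h : Polynomial K) (c : WithTop ℤ) :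
    c ≤ ordv w h ↔ ∀ i, c ≤ w.v (h.coeff i) := by
  unfold ordv
  rw [Finset.le_inf_iff]
  constructor
  · intro H i
    by_cases hi : i ≤ h.natDegree
    · exact H i (by simpa [Nat.lt_succ_iff] using hi)
    · rw [coeff_eq_zero_of_natDegree_lt (by omega), (w.eq_top_iff 0).2 rfl]
      exact le_top
  · intro H i _
    exact H i

theorem exists_ordv_eq {K : Type*} [Field K] (w : AddVal K) (h : Polynomial K) :
    ∃ j, ordv w h = w.v (h.coeff j) := by
  obtain ⟨j, -, hj⟩ := Finset.exists_mem_eq_inf (Finset.range (h.natDegree + 1))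
    ⟨0, by simp⟩ (fun i => w.v (h.coeff i))
  exact ⟨j, hj⟩

theorem coeff_twist {K : Type*} [Field K] (q : ℕ) (hq : q ≠ 0) (h : Polynomial K) (i : ℕ) :
    (twist q h).coeff i = h.coeff i ^ q := by
  unfold twist
  rw [Polynomial.sum_def, finset_sum_coeff]
  simp only [coeff_C_mul, coeff_X_pow]
  simp only [mul_ite, mul_one, mul_zero, Finset.sum_ite_eq]
  split_ifs with hi
  · rfl
  · rw [notMem_support_iff.1 hi, zero_pow hq]

theorem le_mul_pow {K : Type*} [Field K] (w : AddVal K) (θ : K) (hθ : 0 ≤ w.v θ)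
    (c : WithTop ℤ) (g : Polynomial K) (hg : ∀ i, c ≤ w.v (g.coeff i)) (n : ℕ) :
    ∀ i, c ≤ w.v (((X - C θ) ^ n * g).coeff i) := by
  induction n with
  | zero => simpa using hg
  | succ n ih =>
    intro i
    rw [pow_succ', mul_assoc, sub_mul, coeff_sub, coeff_C_mul]
    apply w.le_sub'
    · cases i with
      | zero =>
        rw [coeff_X_mul_zero, (w.eq_top_iff 0).2 rfl]
        exact le_top
      | succ i =>
        rw [coeff_X_mul]
        exact ih i
    · rw [w.map_mul]
      exact le_add_of_nonneg_of_le hθ (ih i)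

/-- If `v θ ≥ 0` and `1 − q ≤ ord_v F < 0`, then the Frobenius difference equation
`g^{(1)} − (t−θ)^n g = F` has no solution `g ∈ K[t]`. -/
theorem no_solution_of_difference_equation
    (p q e : ℕ) (hp : p.Prime) (he : 0 < e) (hq : q = p ^ e)
    (K : Type*) [Field K] [CharP K p] (w : AddVal K)
    (θ : K) (hθ : 0 ≤ w.v θ) (n : ℕ) (hn : 1 ≤ n)
    (F : Polynomial K)
    (hF1 : ((1 - (q : ℤ) : ℤ) : WithTop ℤ) ≤ ordv w F) (hF2 : ordv w F < 0) :
    ¬ ∃ g : Polynomial K, twist q g - (Polynomial.X - Polynomial.C θ) ^ n * g = F := by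
  rintro ⟨g, rfl⟩
  have hq2 : 2 ≤ q := by
    rw [hq]
    exact le_trans hp.two_le (Nat.le_self_pow he.ne' p)
  obtain ⟨j, hj⟩ := exists_ordv_eq w g
  have hall := (le_ordv_iff w g _).1 hj.ge
  by_cases h0 : 0 ≤ w.v (g.coeff j)
  · have hall0 : ∀ i, 0 ≤ w.v (g.coeff i) := fun i => h0.trans (hall i)
    refine absurd hF2 (not_lt.2 ((le_ordv_iff w _ _).2 fun i => ?_))
    rw [coeff_sub, coeff_twist q (by omega)]
    exact w.le_sub' (w.pow_nonneg' _ (hall0 i) q) (le_mul_pow w θ hθ 0 g hall0 n i)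
  · rw [not_le] at h0
    obtain ⟨m, hm⟩ := WithTop.ne_top_iff_exists.1 (ne_top_of_lt h0)
    rw [← hm] at hall h0
    have hm0 : m < 0 := by exact_mod_cast h0
    have hP := le_mul_pow w θ hθ _ g hall n j
    have hFj := (le_ordv_iff w _ _).1 hF1 j
    have hadd := w.add_le ((twist q g - (X - C θ) ^ n * g).coeff j) (((X - C θ) ^ n * g).coeff j)
    rw [← coeff_add, sub_add_cancel, coeff_twist q (by omega), w.v_pow' _ m hm.symm] at hadd
    have hfin := (min_le_min hFj hP).trans hadd
    have hfin' : min (1 - (q : ℤ)) m ≤ q * m := by exact_mod_cast hfin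
    have : (2 : ℤ) ≤ q := by exact_mod_cast hq2
    rcases min_le_iff.1 hfin' with h | h <;> nlinarith
end

section
/- Let L be a field of characteristic p that is an 𝔽_q-algebra with θ ∈ L transcendental over 𝔽_q, let n ≥ 1, and let P_1,…,P_ℓ ∈ C^{⊗n}(L) be nonzero points with associated polynomials f_i := f_{P_i} ∈ L[t]. For an additive valuation v on L define ord_v(P_i) as the minimum of v over the n coordinates of P_i, and set C_v := min( min_{1≤i≤ℓ} ord_v(P_i) + (n−1)·min(0, v(θ)) , ⌈n/(q−1)⌉·min(0, v(θ)) ). Then for any a_1,…,a_ℓ ∈ 𝔽_q[t], the relation a_1·P_1 + ⋯ + a_ℓ·P_ℓ = 0 holds in C^{⊗n}(L) if and only if there exists g ∈ L[t] with g^{(1)} − (t−θ)^n·g = a_1 f_1 + ⋯ + a_ℓ f_ℓ and ord_v(g) ≥ C_v for every additive valuation v on L. -/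
open Polynomial

/-- The `t`-action `φ` on the `n`-th tensor power of the Carlitz module:
`φ(x_1,…,x_n) = (θx_1+x_2, …, θx_{n−1}+x_n, θx_n + x_1^q)`. -/
def carlitzPhi {L : Type*} [Field L] (q n : ℕ) (θ : L) (x : Fin n → L) : Fin n → L :=
  fun i => θ * x i +
    if h : (i : ℕ) + 1 < n then x ⟨(i : ℕ) + 1, h⟩
    else (x ⟨0, Nat.lt_of_le_of_lt (Nat.zero_le _) i.isLt⟩) ^ q

/-- The action of `a ∈ 𝔽_q[t]` on `C^{⊗n}(L)`, namely `a(φ)` applied to `x`; the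
coefficients of `a` act through the ring homomorphism `χ : Fq →+* L`. -/
def carlitzAct {Fq L : Type*} [Field Fq] [Field L] (q n : ℕ) (θ : L) (χ : Fq →+* L)
    (a : Polynomial Fq) (x : Fin n → L) : Fin n → L :=
  ∑ i ∈ Finset.range (a.natDegree + 1), χ (a.coeff i) • (carlitzPhi q n θ)^[i] x

/-- The polynomial `f_P = p_0 + p_1(t−θ) + ⋯ + p_{n−1}(t−θ)^{n−1}` associated to the point
`P = (p_{n−1},…,p_0)` (so `P i.rev` is `p_i`). -/
noncomputable def assocPoly {L : Type*} [Field L] (n : ℕ) (θ : L) (P : Fin n → L) :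
    Polynomial L :=
  ∑ i : Fin n, Polynomial.C (P i.rev) * (Polynomial.X - Polynomial.C θ) ^ (i : ℕ)

/-- `ord_v` of a point of `C^{⊗n}`: the minimum of `v` over its coordinates. -/
noncomputable def ordPt {K : Type*} [Field K] {n : ℕ} (w : AddVal K) (P : Fin n → K) :
    WithTop ℤ :=
  Finset.univ.inf fun i => w.v (P i)

section CarlitzHelpers

theorem cz_twist_eq {L : Type*} [Field L] (p e : ℕ) [Fact p.Prime] [CharP L p] (g : Polynomial L) :
    twist (p ^ e) g = g.map (iterateFrobenius L p e) := by
  unfold twist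
  conv_rhs => rw [g.as_sum_support_C_mul_X_pow]
  rw [Polynomial.sum_def, Polynomial.map_sum]
  simp [iterateFrobenius_def]

theorem cz_X_mul {L : Type*} [Field L] (p e k : ℕ) [Fact p.Prime] [CharP L p] (θ : L)
    (x : Fin (k+1) → L) :
    X * assocPoly (k+1) θ x = assocPoly (k+1) θ (carlitzPhi (p^e) (k+1) θ x) +
      (twist (p^e) (C (-(x 0))) - (X - C θ)^(k+1) * C (-(x 0))) := by
  have h1 : assocPoly (k+1) θ (carlitzPhi (p^e) (k+1) θ x) =
      C θ * assocPoly (k+1) θ x + C ((x 0)^(p^e)) +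
        ∑ i : Fin k, C (x i.castSucc.rev) * (X - C θ)^((i:ℕ)+1) := by
    unfold assocPoly
    rw [Fin.sum_univ_succ, Fin.sum_univ_succ (f := fun i : Fin (k+1) => C (x i.rev) * (X - C θ)^(i:ℕ)), mul_add, Finset.mul_sum]
    have h2 : ∀ i : Fin k, carlitzPhi (p^e) (k+1) θ x i.succ.rev
        = θ * x i.succ.rev + x i.castSucc.rev := by
      intro i
      have hi := i.isLt
      unfold carlitzPhi
      rw [dif_pos (by simp [Fin.val_rev]; omega)]
      congr 2
      ext
      simp [Fin.val_rev]; omega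
    have h3 : carlitzPhi (p^e) (k+1) θ x (Fin.rev 0) = θ * x (Fin.rev 0) + x 0 ^ (p^e) := by
      unfold carlitzPhi
      rw [dif_neg (by simp [Fin.val_rev])]
      rfl
    rw [h3]
    simp only [h2, C_add, C_mul, add_mul, Finset.sum_add_distrib, Fin.val_zero, pow_zero, mul_one,
      Fin.val_succ, mul_assoc]
    ring
  have h4 : (X - C θ) * assocPoly (k+1) θ x = C (x 0) * (X - C θ)^(k+1) +
      ∑ i : Fin k, C (x i.castSucc.rev) * (X - C θ)^((i:ℕ)+1) := by
    unfold assocPoly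
    rw [Fin.sum_univ_castSucc, mul_add, Finset.mul_sum]
    simp only [Fin.rev_last, Fin.val_last, Fin.val_castSucc]
    rw [add_comm]
    congr 1
    · ring
    · exact Finset.sum_congr rfl fun i _ => by ring
  rw [h1, cz_twist_eq, map_C, map_neg, iterateFrobenius_def, C_neg, C_neg]
  linear_combination h4

theorem cz_act {Fq L : Type*} [Field Fq] [Fintype Fq] [Field L] [Algebra Fq L]
    (p e k : ℕ) [Fact p.Prime] [CharP L p] (hFq : Fintype.card Fq = p^e) (θ : L)
    (a : Polynomial Fq) (x : Fin (k+1) → L) :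
    ∃ h : Polynomial L, a.map (algebraMap Fq L) * assocPoly (k+1) θ x =
      assocPoly (k+1) θ (carlitzAct (p^e) (k+1) θ (algebraMap Fq L) a x) +
        (twist (p^e) h - (X - C θ)^(k+1) * h) := by
  have key : ∀ (i : ℕ) (x : Fin (k+1) → L), ∃ h : Polynomial L, X^i * assocPoly (k+1) θ x =
      assocPoly (k+1) θ ((carlitzPhi (p^e) (k+1) θ)^[i] x) +
        (twist (p^e) h - (X - C θ)^(k+1) * h) := by
    intro i
    induction i with
    | zero => intro x; exact ⟨0, by simp [cz_twist_eq]⟩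
    | succ i ih =>
      intro x
      obtain ⟨h, hh⟩ := ih (carlitzPhi (p^e) (k+1) θ x)
      refine ⟨h + X^i * C (-(x 0)), ?_⟩
      have := cz_X_mul p e k θ x
      rw [Function.iterate_succ_apply]
      rw [cz_twist_eq] at *
      rw [Polynomial.map_add, Polynomial.map_mul, Polynomial.map_pow, map_X]
      linear_combination hh + X^i * this
  choose H hH using fun i => key i x
  refine ⟨∑ i ∈ Finset.range (a.natDegree+1), C (algebraMap Fq L (a.coeff i)) * H i, ?_⟩
  have hc : ∀ c : Fq, iterateFrobenius L p e (algebraMap Fq L c) = algebraMap Fq L c := by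
    intro c
    rw [iterateFrobenius_def, ← map_pow, ← hFq, FiniteField.pow_card]
  have hF : assocPoly (k+1) θ (carlitzAct (p^e) (k+1) θ (algebraMap Fq L) a x) =
      ∑ i ∈ Finset.range (a.natDegree+1), C (algebraMap Fq L (a.coeff i)) *
        assocPoly (k+1) θ ((carlitzPhi (p^e) (k+1) θ)^[i] x) := by
    unfold assocPoly carlitzAct
    simp only [Finset.mul_sum]
    rw [Finset.sum_comm]
    refine Finset.sum_congr rfl fun j _ => ?_
    simp only [Finset.sum_apply, Pi.smul_apply, smul_eq_mul, map_sum, C_mul, Finset.sum_mul, mul_assoc]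
  rw [hF, cz_twist_eq, Polynomial.map_sum, Finset.mul_sum, ← Finset.sum_sub_distrib,
    ← Finset.sum_add_distrib]
  conv_lhs => rw [a.as_sum_range_C_mul_X_pow, Polynomial.map_sum, Finset.sum_mul]
  refine Finset.sum_congr rfl fun i _ => ?_
  have := hH i
  rw [cz_twist_eq] at this
  simp only [Polynomial.map_mul, Polynomial.map_pow, map_C, map_X, hc]
  linear_combination C (algebraMap Fq L (a.coeff i)) * this

theorem cz_assoc_degree {L : Type*} [Field L] (n : ℕ) (θ : L) (x : Fin n → L) :
    (assocPoly n θ x).degree < n := by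
  rw [← mem_degreeLT]
  refine Submodule.sum_mem _ fun i _ => ?_
  rw [mem_degreeLT]
  refine lt_of_le_of_lt (degree_mul_le _ _) ?_
  rw [degree_pow, degree_X_sub_C]
  refine lt_of_le_of_lt (add_le_add_left degree_C_le _) ?_
  simp

theorem cz_assoc_inj {L : Type*} [Field L] (n : ℕ) (θ : L) (x : Fin n → L)
    (h : assocPoly n θ x = 0) : x = 0 := by
  have h2 : taylor θ (assocPoly n θ x) = 0 := by rw [h]; simp
  unfold assocPoly at h2
  simp only [map_sum, taylor_apply, mul_comp, C_comp, pow_comp, sub_comp, X_comp,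
    add_sub_cancel_right] at h2
  ext i
  have h3 := congrArg (fun f => f.coeff (i.rev : ℕ)) h2
  simp only [finsetSum_coeff, coeff_C_mul, coeff_X_pow, coeff_zero] at h3
  rw [Finset.sum_eq_single i.rev] at h3
  · simpa using h3
  · intro b _ hb
    rw [if_neg (fun hh => hb (Fin.ext hh.symm)), mul_zero]
  · simp

theorem cz_D_inj {L : Type*} [Field L] (p e n : ℕ) [Fact p.Prime] [CharP L p] (hn : 1 ≤ n) (θ : L)
    (g : Polynomial L) (h : (twist (p^e) g - (X - C θ)^n * g).degree < (n : WithBot ℕ)) : g = 0 := by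
  by_contra hg
  have h1 : (twist (p^e) g).degree = g.degree := by
    rw [cz_twist_eq, degree_map]
  have h2 : ((X - C θ)^n * g).degree = n + g.degree := by
    rw [degree_mul, degree_pow, degree_X_sub_C]; simp
  rw [degree_sub_eq_right_of_degree_lt, h2] at h
  · rw [degree_eq_natDegree hg] at h
    norm_cast at h; omega
  · rw [h1, h2, degree_eq_natDegree hg]
    norm_cast; omega

theorem cz_v_one {L : Type*} [Field L] (w : AddVal L) : w.v 1 = 0 := by
  have h := w.map_mul 1 1
  have h1 : w.v 1 ≠ ⊤ := by rw [Ne, w.eq_top_iff]; exact one_ne_zero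
  obtain ⟨m, hm⟩ := WithTop.ne_top_iff_exists.1 h1
  rw [mul_one, ← hm] at h
  rw [← hm]
  norm_cast at h ⊢
  omega

theorem cz_v_pow {L : Type*} [Field L] (w : AddVal L) (x : L) (r : ℕ) : w.v (x^r) = r • w.v x := by
  induction r with
  | zero => simp [cz_v_one]
  | succ r ih => rw [pow_succ, w.map_mul, ih, succ_nsmul]

theorem cz_v_root {L : Type*} [Field L] (w : AddVal L) (x : L) (r : ℕ) (hr : r ≠ 0)
    (hx : x ^ r = 1) : w.v x = 0 := by
  have h := cz_v_pow w x r
  have h1 : w.v x ≠ ⊤ := by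
    rw [Ne, w.eq_top_iff]; rintro rfl; simp [hr] at hx
  obtain ⟨m, hm⟩ := WithTop.ne_top_iff_exists.1 h1
  rw [hx, cz_v_one, ← hm] at h
  rw [← hm]
  norm_cast at h ⊢
  simpa [hr] using h.symm

theorem cz_v_neg {L : Type*} [Field L] (w : AddVal L) (x : L) : w.v (-x) = w.v x := by
  rw [← neg_one_mul, w.map_mul, cz_v_root w (-1) 2 (by simp) (by simp), zero_add]

theorem cz_v_sum {L ι : Type*} [Field L] (w : AddVal L) (c : WithTop ℤ) (s : Finset ι) (f : ι → L)
    (h : ∀ i ∈ s, c ≤ w.v (f i)) : c ≤ w.v (∑ i ∈ s, f i) := by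
  refine Finset.sum_induction f (fun y => c ≤ w.v y)
    (fun a b ha hb => (le_min ha hb).trans (w.add_le a b)) ?_ h
  show c ≤ w.v 0
  rw [(w.eq_top_iff 0).2 rfl]; exact le_top

theorem cz_mul_bd {L : Type*} [Field L] (w : AddVal L) (c d : WithTop ℤ) (f g : Polynomial L)
    (hf : ∀ i, c ≤ w.v (f.coeff i)) (hg : ∀ i, d ≤ w.v (g.coeff i)) (i : ℕ) :
    c + d ≤ w.v ((f * g).coeff i) := by
  rw [coeff_mul]
  refine cz_v_sum w _ _ _ fun x _ => ?_
  rw [w.map_mul]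
  exact add_le_add (hf _) (hg _)

theorem cz_pow_bd {L : Type*} [Field L] (w : AddVal L) (θ : L) (r : ℕ) (i : ℕ) :
    r • min 0 (w.v θ) ≤ w.v (((X - C θ)^r).coeff i) := by
  induction r generalizing i with
  | zero =>
    rw [pow_zero, coeff_one, zero_nsmul]
    split_ifs
    · rw [cz_v_one]
    · rw [(w.eq_top_iff 0).2 rfl]; exact le_top
  | succ r ih =>
    rw [pow_succ, succ_nsmul]
    refine cz_mul_bd w _ _ _ _ ih (fun j => ?_) i
    rw [sub_eq_add_neg, coeff_add, coeff_neg]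
    refine le_trans (le_min ?_ ?_) (w.add_le _ _)
    · rw [coeff_X]
      split_ifs
      · rw [cz_v_one]; exact min_le_left _ _
      · rw [(w.eq_top_iff 0).2 rfl]; exact le_top
    · rw [cz_v_neg, coeff_C]
      split_ifs
      · exact min_le_right _ _
      · rw [(w.eq_top_iff 0).2 rfl]; exact le_top

theorem cz_assoc_bd {L : Type*} [Field L] (w : AddVal L) (θ : L) (n : ℕ) (x : Fin n → L) (i : ℕ) :
    ordPt w x + (n-1) • min 0 (w.v θ) ≤ w.v ((assocPoly n θ x).coeff i) := by
  unfold assocPoly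
  rw [finsetSum_coeff]
  refine cz_v_sum w _ _ _ fun j _ => ?_
  rw [coeff_C_mul, w.map_mul]
  refine add_le_add (Finset.inf_le (Finset.mem_univ _)) (le_trans ?_ (cz_pow_bd w θ j i))
  have h : (n - 1) = (n - 1 - j) + j := by have := j.isLt; omega
  rw [h, add_nsmul]
  exact add_le_of_nonpos_left (nsmul_nonpos (min_le_left _ _) _)

theorem cz_bound {L : Type*} [Field L] (w : AddVal L) (θ : L) (p e n : ℕ) [Fact p.Prime] [CharP L p]
    (he : 0 < e) (g f : Polynomial L) (hg : twist (p^e) g - (X - C θ)^n * g = f) (B : WithTop ℤ)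
    (hB : ∀ i, B ≤ w.v (f.coeff i)) :
    min B ((⌈(n : ℚ) / (((p^e : ℕ) : ℚ) - 1)⌉.toNat) • min 0 (w.v θ)) ≤ ordv w g := by
  have hq : 2 ≤ p^e := (Fact.out : p.Prime).two_le.trans (Nat.le_self_pow he.ne' p)
  have hk : n ≤ ⌈(n : ℚ) / (((p^e : ℕ) : ℚ) - 1)⌉.toNat * (p^e - 1) := by
    have h1 : (0:ℚ) < ((p^e : ℕ) : ℚ) - 1 := by
      have : (2:ℚ) ≤ ((p^e : ℕ) : ℚ) := by exact_mod_cast hq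
      linarith
    have h2 : (n : ℚ) / (((p^e : ℕ) : ℚ) - 1) ≤ (⌈(n : ℚ) / (((p^e : ℕ) : ℚ) - 1)⌉.toNat : ℚ) :=
      (Int.le_ceil _).trans (by exact_mod_cast Int.self_le_toNat _)
    rw [div_le_iff₀ h1] at h2
    have h3 : (((p^e - 1 : ℕ)) : ℚ) = ((p^e : ℕ) : ℚ) - 1 := by
      rw [Nat.cast_sub (by omega)]; simp
    replace h2 := h2.trans_eq (congrArg _ h3.symm)
    generalize ⌈(n : ℚ) / (((p^e : ℕ) : ℚ) - 1)⌉.toNat = K at h2 ⊢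
    exact_mod_cast h2
  generalize ⌈(n : ℚ) / (((p^e : ℕ) : ℚ) - 1)⌉.toNat = K at hk ⊢
  obtain ⟨j, -, hj⟩ := Finset.exists_min_image (Finset.range (g.natDegree+1))
    (fun i => w.v (g.coeff i)) ⟨0, by simp⟩
  have hj' : ∀ i, w.v (g.coeff j) ≤ w.v (g.coeff i) := by
    intro i
    by_cases hi : i ≤ g.natDegree
    · exact hj i (by simp; omega)
    · rw [coeff_eq_zero_of_natDegree_lt (show g.natDegree < i by omega), (w.eq_top_iff 0).2 rfl]; exact le_top
  refine le_trans ?_ (Finset.le_inf fun i _ => hj' i)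
  by_cases htop : w.v (g.coeff j) = ⊤
  · rw [htop]; exact le_top
  obtain ⟨s, hs⟩ := WithTop.ne_top_iff_exists.1 htop
  have hm0 : min 0 (w.v θ) ≤ 0 := min_le_left _ _
  have hmain : min B (n • min 0 (w.v θ) + w.v (g.coeff j)) ≤ (p^e) • w.v (g.coeff j) := by
    have h1 : (g.coeff j)^(p^e) = f.coeff j + ((X - C θ)^n * g).coeff j := by
      rw [← hg, cz_twist_eq, coeff_sub, coeff_map, iterateFrobenius_def]; ring
    rw [← cz_v_pow, h1]
    exact le_trans (min_le_min (hB j) (cz_mul_bd w _ _ _ _ (cz_pow_bd w θ n) hj' j)) (w.add_le _ _)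
  obtain ⟨m, hm⟩ := WithTop.ne_top_iff_exists.1 (ne_top_of_le_ne_top (by simp) hm0)
  rw [← hm] at hm0 hmain ⊢
  rw [← hs] at hmain ⊢
  have hm0' : m ≤ 0 := by exact_mod_cast hm0
  clear hj hj' hm hs htop
  generalize p^e = Q at *
  obtain ⟨R, rfl⟩ : ∃ R, Q = R + 1 := ⟨Q - 1, by omega⟩
  simp only [← WithTop.coe_nsmul, ← WithTop.coe_add, min_le_iff, WithTop.coe_le_coe, nsmul_eq_mul,
    Nat.add_sub_cancel] at *
  push_cast at *
  have hR : (1:ℤ) ≤ R := by omega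
  have hk' : (n:ℤ) ≤ K * R := by exact_mod_cast hk
  by_cases hs0 : 0 ≤ s
  · right
    nlinarith [mul_nonneg (Int.natCast_nonneg K) (neg_nonneg.2 hm0')]
  · rcases hmain with h | h
    · left
      refine h.trans ?_
      exact_mod_cast (by nlinarith : ((R:ℤ)+1) * s ≤ s)
    · right
      have : (R:ℤ) * (K * m) ≤ R * s := by nlinarith
      exact le_of_mul_le_mul_left this (by omega)

theorem cz_alg_bd {Fq L : Type*} [Field Fq] [Fintype Fq] [Field L] [Algebra Fq L] (w : AddVal L)
    (c : Fq) : 0 ≤ w.v (algebraMap Fq L c) := by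
  by_cases hc : c = 0
  · rw [hc, map_zero, (w.eq_top_iff 0).2 rfl]; exact le_top
  · rw [cz_v_root w _ (Fintype.card Fq - 1)]
    · have := Fintype.one_lt_card (α := Fq); omega
    · rw [← map_pow, FiniteField.pow_card_sub_one_eq_one c hc, map_one]

end CarlitzHelpers

/-- `Σ a_i·P_i = 0` in `C^{⊗n}(L)` iff the difference equation
`g^{(1)} − (t−θ)^n g = Σ a_i f_{P_i}` has a solution `g ∈ L[t]` with `ord_v g ≥ C_v` for
every additive valuation `v` on `L`, where
`C_v = min(min_i ord_v(P_i) + (n−1)·min(0, vθ), ⌈n/(q−1)⌉·min(0, vθ))`. -/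
theorem carlitz_relation_iff_bounded_solution
    (p q e : ℕ) (hp : p.Prime) (he : 0 < e) (hq : q = p ^ e)
    (Fq : Type*) [Field Fq] [Fintype Fq] (hFq : Fintype.card Fq = q)
    (L : Type*) [Field L] [Algebra Fq L] [CharP L p]
    (θ : L) (hθ : Transcendental Fq θ)
    (n : ℕ) (hn : 1 ≤ n) (ℓ : ℕ) (P : Fin ℓ → Fin n → L) (hP : ∀ i, P i ≠ 0)
    (a : Fin ℓ → Polynomial Fq) :
    (∑ i : Fin ℓ, carlitzAct q n θ (algebraMap Fq L) (a i) (P i) = 0) ↔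
      ∃ g : Polynomial L,
        (twist q g - (Polynomial.X - Polynomial.C θ) ^ n * g =
          ∑ i : Fin ℓ, ((a i).map (algebraMap Fq L)) * assocPoly n θ (P i)) ∧
        ∀ w : AddVal L,
          min ((Finset.univ.inf fun i : Fin ℓ => ordPt w (P i)) +
                (n - 1) • min 0 (w.v θ))
              ((⌈(n : ℚ) / ((q : ℚ) - 1)⌉.toNat) • min 0 (w.v θ)) ≤ ordv w g := by
  classical
  haveI : Fact p.Prime := ⟨hp⟩
  subst hq
  obtain ⟨k, rfl⟩ : ∃ k, n = k + 1 := ⟨n - 1, by omega⟩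
  choose H hH using fun i => cz_act p e k hFq θ (a i) (P i)
  have hsum : ∑ i : Fin ℓ, ((a i).map (algebraMap Fq L)) * assocPoly (k+1) θ (P i) =
      assocPoly (k+1) θ (∑ i : Fin ℓ, carlitzAct (p^e) (k+1) θ (algebraMap Fq L) (a i) (P i)) +
        (twist (p^e) (∑ i, H i) - (X - C θ)^(k+1) * ∑ i, H i) := by
    have hF : assocPoly (k+1) θ (∑ i : Fin ℓ, carlitzAct (p^e) (k+1) θ (algebraMap Fq L) (a i) (P i))
        = ∑ i : Fin ℓ, assocPoly (k+1) θ (carlitzAct (p^e) (k+1) θ (algebraMap Fq L) (a i) (P i)) := by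
      unfold assocPoly
      rw [Finset.sum_comm]
      refine Finset.sum_congr rfl fun j _ => ?_
      simp only [Finset.sum_apply, map_sum, Finset.sum_mul]
    rw [hF, cz_twist_eq, Polynomial.map_sum, Finset.mul_sum, ← Finset.sum_sub_distrib,
      ← Finset.sum_add_distrib]
    refine Finset.sum_congr rfl fun i _ => ?_
    rw [hH i, cz_twist_eq]
  constructor
  · intro h
    rw [h] at hsum
    have h0 : assocPoly (k+1) θ (0 : Fin (k+1) → L) = 0 := by simp [assocPoly]
    rw [h0, zero_add] at hsum
    refine ⟨∑ i, H i, hsum.symm, fun w => ?_⟩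
    refine cz_bound w θ p e (k+1) he _ _ hsum.symm _ fun j => ?_
    rw [finsetSum_coeff]
    refine cz_v_sum w _ _ _ fun i _ => ?_
    rw [← zero_add (_ + _)]
    refine cz_mul_bd w _ _ _ _ (fun r => ?_) (fun r => ?_) j
    · rw [coeff_map]; exact cz_alg_bd w _
    · exact le_trans (add_le_add_left (Finset.inf_le (Finset.mem_univ i)) _)
        (cz_assoc_bd w θ (k+1) (P i) r)
  · rintro ⟨g, hg, -⟩
    rw [hsum] at hg
    have hD : twist (p^e) (g - ∑ i, H i) - (X - C θ)^(k+1) * (g - ∑ i, H i) =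
        assocPoly (k+1) θ
          (∑ i : Fin ℓ, carlitzAct (p^e) (k+1) θ (algebraMap Fq L) (a i) (P i)) := by
      rw [cz_twist_eq, cz_twist_eq] at hg
      rw [cz_twist_eq, Polynomial.map_sub]
      linear_combination hg
    have hz := cz_D_inj p e (k+1) hn θ (g - ∑ i, H i) (by rw [hD]; exact cz_assoc_degree _ _ _)
    rw [hz] at hD
    refine cz_assoc_inj (k+1) θ _ ?_
    rw [← hD, cz_twist_eq]; simp
end
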